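/- Let n > m ≥ 1 be integers. Then there exist a real number H > 0 and a real number C > c₀(H) such that P(H,m,n,C) = π, where q_C(v) = C − v²(v^{−n}+H)^{2/m} − v² for v > 0, v₀(H) is its unique positive critical point, c₀(H) = v₀(H)²(v₀(H)^{−n}+H)^{2/m}+v₀(H)², t₁(C) < v₀(H) < t₂(C) are the two positive zeros of q_C, and P(H,m,n,C) = 2∫_{t₁(C)}^{t₂(C)} √C·t·(t^{−n}+H)^{1/m}/((C−t²)·√(q_C(t))) dt. -/

import Mathlib

open Real Set Filter MeasureTheory

/-- The function `y ↦ (K y ^ p + H) ^ q`. -/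
noncomputable def powProfile (p q K H y : ℝ) : ℝ := (K * y ^ p + H) ^ q

/-- The second derivative of `powProfile` in `y`. -/
noncomputable def powProfileDeriv2 (p q K H y : ℝ) : ℝ :=
  K * p * q * (K * y ^ p + H) ^ (q - 2) * y ^ (p - 2) * ((p * q - 1) * (K * y ^ p) + (p - 1) * H)

/-- The coefficient `K` for which `y ↦ K y ^ p + H` interpolates `(y - 1) ^ q⁻¹` at `a`, `b`. -/
noncomputable def interpSlope (p q a b : ℝ) : ℝ :=
  ((b - 1) ^ q⁻¹ - (a - 1) ^ q⁻¹) / (b ^ p - a ^ p)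

/-- The constant `H` for which `y ↦ K y ^ p + H` interpolates `(y - 1) ^ q⁻¹` at `a`, `b`. -/
noncomputable def interpConst (p q a b : ℝ) : ℝ :=
  (a - 1) ^ q⁻¹ - interpSlope p q a b * a ^ p

theorem le_of_deriv2_le {f f' f'' : ℝ → ℝ} {a b κ : ℝ}
    (hf : ∀ x ∈ Icc a b, HasDerivAt f (f' x) x) (hf' : ∀ x ∈ Icc a b, HasDerivAt f' (f'' x) x)
    (h : ∀ x ∈ Icc a b, f'' x ≤ -(2 * κ)) (ha : f a = 0) (hb : f b = 0) {y : ℝ}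
    (hy : y ∈ Icc a b) : κ * ((y - a) * (b - y)) ≤ f y := by
  have hconc : ConcaveOn ℝ (Icc a b) (fun x => f x - κ * ((x - a) * (b - x))) := by
    refine concaveOn_of_hasDerivWithinAt2_nonpos (convex_Icc a b) (f' := fun x =>
      f' x - κ * ((b - x) - (x - a))) (f'' := fun x => f'' x + 2 * κ) ?_ ?_ ?_ ?_
    · exact (ContinuousOn.sub (fun x hx => (hf x hx).continuousAt.continuousWithinAt)
        (by fun_prop))
    · intro x hx
      have := (hf x (interior_subset hx)).sub
        ((((hasDerivAt_id x).sub_const a).mul ((hasDerivAt_id x).const_sub b)).const_mul κ)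
      refine (this.congr_deriv ?_).hasDerivWithinAt
      simp only [id]; ring
    · intro x hx
      have := (hf' x (interior_subset hx)).sub
        ((((hasDerivAt_id x).const_sub b).sub ((hasDerivAt_id x).sub_const a)).const_mul κ)
      refine (this.congr_deriv ?_).hasDerivWithinAt
      ring
    · intro x hx
      linarith [h x (interior_subset hx)]
  have hab : a ≤ b := hy.1.trans hy.2
  have := hconc.min_le_of_mem_Icc (left_mem_Icc.2 hab) (right_mem_Icc.2 hab) hy
  simp only [ha, hb] at this
  simp at this
  linarith

section powProfile

variable {p q K H y : ℝ}

theorem hasDerivAt_powProfile (hy : 0 < y) (hB : 0 < K * y ^ p + H) :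
    HasDerivAt (powProfile p q K H) (q * (K * y ^ p + H) ^ (q - 1) * (K * (p * y ^ (p - 1)))) y := by
  have := ((((hasDerivAt_id y).rpow_const (p := p) (Or.inl hy.ne')).const_mul K).add_const H).rpow_const
    (p := q) (Or.inl hB.ne')
  refine this.congr_deriv ?_
  simp; ring

theorem hasDerivAt_deriv_powProfile (hy : 0 < y) (hB : 0 < K * y ^ p + H) :
    HasDerivAt (fun y => q * (K * y ^ p + H) ^ (q - 1) * (K * (p * y ^ (p - 1))))
      (powProfileDeriv2 p q K H y) y := by
  have h1 := ((((hasDerivAt_id y).rpow_const (p := p) (Or.inl hy.ne')).const_mul K).add_const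
    H).rpow_const (p := q - 1) (Or.inl hB.ne')
  have h2 := (((hasDerivAt_id y).rpow_const (p := p - 1) (Or.inl hy.ne')).const_mul p).const_mul K
  refine ((h1.const_mul q).mul h2).congr_deriv ?_
  simp only [id, powProfileDeriv2]
  have e1 : q - 1 - 1 = q - 2 := by ring
  have e2 : p - 1 - 1 = p - 2 := by ring
  have e3 : (K * y ^ p + H) ^ (q - 1) = (K * y ^ p + H) ^ (q - 2) * (K * y ^ p + H) := by
    rw [← rpow_add_one hB.ne']; congr 1; ring
  have e4 : y ^ (p - 1) = y ^ (p - 2) * y := by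
    rw [← rpow_add_one hy.ne']; congr 1; ring
  have e5 : y ^ p = y ^ (p - 2) * y * y := by
    rw [← rpow_add_one hy.ne', ← rpow_add_one hy.ne']; congr 1; ring
  rw [e1, e2, e3, e4]
  generalize (K * y ^ p + H) ^ (q - 2) = Z
  rw [e5]
  ring

theorem powProfileDeriv2_pos (hp : 1 ≤ p) (hq : 0 < q) (hpq : 1 < p * q) (hK : 0 < K)
    (hH : 0 < H) (hy : 0 < y) : 0 < powProfileDeriv2 p q K H y := by
  unfold powProfileDeriv2
  have h1 : 0 < p * q - 1 := by linarith
  have h2 : 0 ≤ p - 1 := by linarith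
  have h3 : 0 < p := by linarith
  positivity

end powProfile

section interp

variable {p q a b : ℝ}

theorem interpSlope_pos (hp : 0 < p) (hq : 0 < q) (ha : 1 < a) (hab : a < b) :
    0 < interpSlope p q a b := by
  refine div_pos (sub_pos.2 ?_) (sub_pos.2 ?_)
  · exact rpow_lt_rpow (by linarith) (by linarith) (by positivity)
  · exact rpow_lt_rpow (by linarith) hab hp

theorem interp_left : interpSlope p q a b * a ^ p + interpConst p q a b = (a - 1) ^ q⁻¹ := by
  unfold interpConst; ring

theorem interp_right (hp : 0 < p) (ha : 0 < a) (hab : a < b) :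
    interpSlope p q a b * b ^ p + interpConst p q a b = (b - 1) ^ q⁻¹ := by
  have : b ^ p - a ^ p ≠ 0 := (sub_pos.2 (rpow_lt_rpow ha.le hab hp)).ne'
  unfold interpConst interpSlope; field_simp; ring

theorem interpConst_pos (hp : 0 < p) (hq : 0 < q) (hpq : 1 < p * q) (ha : 1 < a)
    (h : a ≤ p * q * (a - 1)) (hab : a < b) : 0 < interpConst p q a b := by
  have ha0 : 0 < a := by linarith
  have ha1 : 0 < a - 1 := by linarith
  have hb1 : 0 < b - 1 := by linarith
  have hY : a ^ p < b ^ p := rpow_lt_rpow ha0.le hab hp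
  have key : (b - 1) / (a - 1) < (b / a) ^ (p * q) := by
    have h1 := one_add_mul_self_lt_rpow_one_add (s := b / a - 1) (p := p * q)
      (by have : 0 < b / a := by have := ha0.trans hab; positivity
          linarith) (by rw [sub_ne_zero, ne_eq, div_eq_one_iff_eq ha0.ne']; exact hab.ne') hpq
    rw [add_sub_cancel] at h1
    refine lt_of_le_of_lt ?_ h1
    rw [div_le_iff₀ ha1]
    have : (1 + p * q * (b / a - 1)) * (a - 1) = (a - 1) + (p * q * (a - 1)) * ((b - a) / a) := by
      field_simp
    rw [this]
    have h2 : a * ((b - a) / a) ≤ p * q * (a - 1) * ((b - a) / a) :=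
      mul_le_mul_of_nonneg_right h (div_nonneg (by linarith) ha0.le)
    rw [mul_div_cancel₀ _ ha0.ne'] at h2
    linarith
  have key2 : ((b - 1) / (a - 1)) ^ q⁻¹ < (b / a) ^ p := by
    have := rpow_lt_rpow (by positivity) key (inv_pos.2 hq)
    rwa [← rpow_mul (by have := ha0.trans hab; positivity), mul_inv_cancel_right₀ hq.ne'] at this
  rw [div_rpow hb1.le ha1.le, div_rpow (ha0.trans hab).le ha0.le,
    div_lt_div_iff₀ (by positivity) (by positivity)] at key2
  have hd : 0 < b ^ p - a ^ p := by linarith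
  have : interpConst p q a b =
      (b ^ p * (a - 1) ^ q⁻¹ - (b - 1) ^ q⁻¹ * a ^ p) / (b ^ p - a ^ p) := by
    unfold interpConst interpSlope; field_simp; ring
  rw [this]
  exact div_pos (by linarith) hd

theorem tendsto_interpSlope (hp : 0 < p) (ha : 1 < a) :
    Tendsto (fun b => interpSlope p q a b) (nhdsWithin a (Ioi a))
      (nhds (q⁻¹ * (a - 1) ^ (q⁻¹ - 1) / (p * a ^ (p - 1)))) := by
  have ha0 : 0 < a := by linarith
  have h1 : HasDerivAt (fun x : ℝ => (x - 1) ^ q⁻¹) (q⁻¹ * (a - 1) ^ (q⁻¹ - 1)) a := by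
    refine (((hasDerivAt_id a).sub_const 1).rpow_const (p := q⁻¹)
      (Or.inl (sub_pos.2 ha).ne')).congr_deriv ?_
    simp
  have h2 : HasDerivAt (fun x : ℝ => x ^ p) (p * a ^ (p - 1)) a :=
    hasDerivAt_rpow_const (Or.inl ha0.ne')
  have hs : Ioi a ⊆ {a}ᶜ := fun x hx => (ne_of_gt hx : x ≠ a)
  have h3 := ((hasDerivAt_iff_tendsto_slope.1 h1).mono_left (nhdsWithin_mono a hs)).div
    ((hasDerivAt_iff_tendsto_slope.1 h2).mono_left (nhdsWithin_mono a hs)) (by positivity)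
  refine h3.congr' ?_
  filter_upwards [self_mem_nhdsWithin] with x hx
  have : x - a ≠ 0 := sub_ne_zero.2 (ne_of_gt hx)
  simp only [Pi.div_apply, slope_def_field, interpSlope]
  rw [div_div_div_cancel_right₀ this]

theorem powProfileDeriv2_limit (hp : 0 < p) (hq : 0 < q) (ha : 1 < a) {K : ℝ}
    (hK : K = q⁻¹ * (a - 1) ^ (q⁻¹ - 1) / (p * a ^ (p - 1))) :
    powProfileDeriv2 p q K ((a - 1) ^ q⁻¹ - K * a ^ p) a =
      ((q - 1) * a / (q * (a - 1)) + (p - 1)) / a := by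
  have ha0 : 0 < a := by linarith
  have ha1 : 0 < a - 1 := by linarith
  have hE : 0 < (a - 1) ^ q⁻¹ := by positivity
  have e1 : (a - 1) ^ (q⁻¹ - 1) = (a - 1) ^ q⁻¹ / (a - 1) := rpow_sub_one ha1.ne' _
  have e2 : a ^ (p - 1) = a ^ p / a := rpow_sub_one ha0.ne' _
  have e3 : a ^ (p - 2) = a ^ p / a ^ 2 := by rw [rpow_sub ha0]; norm_num
  have hKa : K * a ^ p = a * (a - 1) ^ q⁻¹ / (p * q * (a - 1)) := by
    rw [hK, e1, e2]
    have : 0 < a ^ p := by positivity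
    field_simp
  have e4 : ((a - 1) ^ q⁻¹) ^ (q - 2) = (a - 1) / ((a - 1) ^ q⁻¹) ^ 2 := by
    rw [rpow_sub hE, ← rpow_mul ha1.le, inv_mul_cancel₀ hq.ne', rpow_one]; norm_num
  unfold powProfileDeriv2
  rw [add_sub_cancel, e4, e3]
  have : K * p * q * ((a - 1) / ((a - 1) ^ q⁻¹) ^ 2) * (a ^ p / a ^ 2) =
    p * q * (K * a ^ p) * ((a - 1) / ((a - 1) ^ q⁻¹) ^ 2) / a ^ 2 := by ring
  rw [this, hKa]
  field_simp
  ring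

end interp

theorem eventually_forall_mem_Icc {a : ℝ} {P : ℝ → Prop} (h : ∀ᶠ x in nhds a, P x) :
    ∀ᶠ b in nhdsWithin a (Ioi a), ∀ x ∈ Icc a b, P x := by
  obtain ⟨δ, hδ, h⟩ := Metric.eventually_nhds_iff.1 h
  filter_upwards [Ioo_mem_nhdsGT (lt_add_of_pos_right a hδ)] with b hb x hx
  refine h ?_
  rw [Real.dist_eq, abs_of_nonneg (by linarith [hx.1])]
  linarith [hx.2, hb.2]

theorem continuousAt_powProfile {p q : ℝ} {z : ℝ × ℝ × ℝ} (hy : 0 < z.2.2)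
    (hB : 0 < z.1 * z.2.2 ^ p + z.2.1) :
    ContinuousAt (fun z : ℝ × ℝ × ℝ => powProfile p q z.1 z.2.1 z.2.2) z := by
  unfold powProfile
  have h1 : ContinuousAt (fun z : ℝ × ℝ × ℝ => z.2.2 ^ p) z :=
    ContinuousAt.rpow_const (by fun_prop) (Or.inl hy.ne')
  exact ContinuousAt.rpow_const (by fun_prop) (Or.inl hB.ne')

theorem continuousAt_powProfileDeriv2 {p q : ℝ} {z : ℝ × ℝ × ℝ} (hy : 0 < z.2.2)
    (hB : 0 < z.1 * z.2.2 ^ p + z.2.1) :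
    ContinuousAt (fun z : ℝ × ℝ × ℝ => powProfileDeriv2 p q z.1 z.2.1 z.2.2) z := by
  unfold powProfileDeriv2
  have h1 : ContinuousAt (fun z : ℝ × ℝ × ℝ => z.2.2 ^ p) z :=
    ContinuousAt.rpow_const (by fun_prop) (Or.inl hy.ne')
  have h2 : ContinuousAt (fun z : ℝ × ℝ × ℝ => z.2.2 ^ (p - 2)) z :=
    ContinuousAt.rpow_const (by fun_prop) (Or.inl hy.ne')
  have h3 : ContinuousAt (fun z : ℝ × ℝ × ℝ => (z.1 * z.2.2 ^ p + z.2.1) ^ (q - 2)) z :=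
    ContinuousAt.rpow_const (by fun_prop) (Or.inl hB.ne')
  fun_prop

section interp

variable {p q a b : ℝ}

theorem eventually_interp (hp : 0 < p) (ha : 1 < a) {K : ℝ}
    (hK : K = q⁻¹ * (a - 1) ^ (q⁻¹ - 1) / (p * a ^ (p - 1))) {Q : ℝ × ℝ × ℝ → Prop}
    (h : ∀ᶠ z in nhds (K, (a - 1) ^ q⁻¹ - K * a ^ p, a), Q z) :
    ∀ᶠ b in nhdsWithin a (Ioi a), ∀ x ∈ Icc a b,
      Q (interpSlope p q a b, interpConst p q a b, x) := by
  have hs := tendsto_interpSlope (q := q) hp ha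
  rw [← hK] at hs
  have hc : Tendsto (fun b => interpConst p q a b) (nhdsWithin a (Ioi a))
      (nhds ((a - 1) ^ q⁻¹ - K * a ^ p)) := tendsto_const_nhds.sub (hs.mul_const _)
  rw [nhds_prod_eq] at h
  obtain ⟨P₁, h₁, P₂, h₂, h⟩ := eventually_prod_iff.1 h
  rw [nhds_prod_eq] at h₂
  obtain ⟨P₃, h₃, P₄, h₄, h'⟩ := eventually_prod_iff.1 h₂
  filter_upwards [hs.eventually h₁, hc.eventually h₃, eventually_forall_mem_Icc h₄]
    with b hb₁ hb₃ hb₄ x hx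
  exact h hb₁ (h' hb₃ (hb₄ x hx))

/-- The height of `y - 1` above the profile interpolating it at `a` and `b`. -/
noncomputable def interpGap (p q a b y : ℝ) : ℝ :=
  y - 1 - powProfile p q (interpSlope p q a b) (interpConst p q a b) y

theorem interpGap_left (hq : 0 < q) (ha : 1 < a) : interpGap p q a b a = 0 := by
  unfold interpGap powProfile
  rw [interp_left, ← rpow_mul (by linarith), inv_mul_cancel₀ hq.ne', rpow_one, sub_self]

theorem interpGap_right (hp : 0 < p) (hq : 0 < q) (ha : 1 < a) (hab : a < b) :
    interpGap p q a b b = 0 := by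
  unfold interpGap powProfile
  rw [interp_right hp (by linarith) hab, ← rpow_mul (by linarith), inv_mul_cancel₀ hq.ne',
    rpow_one, sub_self]

theorem interp_pos (hp : 0 < p) (hq : 0 < q) (hpq : 1 < p * q) (ha : 1 < a)
    (h : a ≤ p * q * (a - 1)) (hab : a < b) {y : ℝ} (hy : 0 < y) :
    0 < interpSlope p q a b * y ^ p + interpConst p q a b := by
  have := interpSlope_pos hp hq ha hab
  have := interpConst_pos hp hq hpq ha h hab
  positivity

theorem interpGap_lower (hp : 0 < p) (hq : 0 < q) (hpq : 1 < p * q) (ha : 1 < a)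
    (h : a ≤ p * q * (a - 1)) (hab : a < b) {κ : ℝ} (hκ : ∀ x ∈ Icc a b,
      2 * κ ≤ powProfileDeriv2 p q (interpSlope p q a b) (interpConst p q a b) x) {y : ℝ}
    (hy : y ∈ Icc a b) : κ * ((y - a) * (b - y)) ≤ interpGap p q a b y := by
  have h0 : ∀ x ∈ Icc a b, 0 < x := fun x hx => by linarith [hx.1]
  refine le_of_deriv2_le
    (fun x hx => ((hasDerivAt_id x).sub_const 1).sub
      (hasDerivAt_powProfile (h0 x hx) (interp_pos hp hq hpq ha h hab (h0 x hx))))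
    (fun x hx => (hasDerivAt_const x (1 : ℝ)).sub
      (hasDerivAt_deriv_powProfile (h0 x hx) (interp_pos hp hq hpq ha h hab (h0 x hx))))
    (fun x hx => ?_) (interpGap_left hq ha) (interpGap_right hp hq ha hab) hy
  linarith [hκ x hx]

theorem interpGap_upper (hp : 0 < p) (hq : 0 < q) (hpq : 1 < p * q) (ha : 1 < a)
    (h : a ≤ p * q * (a - 1)) (hab : a < b) {κ : ℝ} (hκ : ∀ x ∈ Icc a b,
      powProfileDeriv2 p q (interpSlope p q a b) (interpConst p q a b) x ≤ 2 * κ) {y : ℝ}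
    (hy : y ∈ Icc a b) : interpGap p q a b y ≤ κ * ((y - a) * (b - y)) := by
  have h0 : ∀ x ∈ Icc a b, 0 < x := fun x hx => by linarith [hx.1]
  have := le_of_deriv2_le (f := fun x => -interpGap p q a b x) (κ := -κ)
    (fun x hx => (((hasDerivAt_id x).sub_const 1).sub
      (hasDerivAt_powProfile (h0 x hx) (interp_pos hp hq hpq ha h hab (h0 x hx)))).neg)
    (fun x hx => ((hasDerivAt_const x (1 : ℝ)).sub
      (hasDerivAt_deriv_powProfile (h0 x hx) (interp_pos hp hq hpq ha h hab (h0 x hx)))).neg)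
    (fun x hx => by linarith [hκ x hx]) (by simp [interpGap_left hq ha])
    (by simp [interpGap_right hp hq ha hab]) hy
  linarith

theorem continuousOn_interpSlope (hp : 0 < p) (hq : 0 < q) {ε : ℝ} (hε : 0 < ε) :
    ContinuousOn (fun a => interpSlope p q a (a + ε)) (Ioi 1) := by
  intro a ha
  have ha : 1 < a := ha
  refine ContinuousAt.continuousWithinAt ?_
  unfold interpSlope
  have h0 := rpow_lt_rpow (by linarith) (lt_add_of_pos_right a hε) hp
  refine ContinuousAt.div ?_ ?_ (by linarith)
  · exact (ContinuousAt.rpow_const (by fun_prop) (Or.inr (by positivity))).sub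
      (ContinuousAt.rpow_const (by fun_prop) (Or.inr (by positivity)))
  · exact (ContinuousAt.rpow_const (by fun_prop) (Or.inr (by positivity))).sub
      (ContinuousAt.rpow_const (by fun_prop) (Or.inr (by positivity)))

theorem continuousOn_interpConst (hp : 0 < p) (hq : 0 < q) {ε : ℝ} (hε : 0 < ε) :
    ContinuousOn (fun a => interpConst p q a (a + ε)) (Ioi 1) := by
  unfold interpConst
  refine ContinuousOn.sub ?_ ((continuousOn_interpSlope hp hq hε).mul ?_)
  · exact ContinuousOn.rpow_const (by fun_prop) (fun _ _ => Or.inr (by positivity))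
  · exact ContinuousOn.rpow_const (by fun_prop) (fun _ _ => Or.inr hp.le)

theorem exists_pos_le_deriv2 (hp : 1 ≤ p) (hq : 0 < q) (hpq : 1 < p * q) {α β ε : ℝ}
    (hα : 1 < α) (h : ∀ a ∈ Icc α β, a ≤ p * q * (a - 1)) (hαβ : α ≤ β) (hε : 0 < ε) :
    ∃ κ, 0 < κ ∧ ∀ a ∈ Icc α β, ∀ x ∈ Icc a (a + ε), 2 * κ ≤
      powProfileDeriv2 p q (interpSlope p q a (a + ε)) (interpConst p q a (a + ε)) x := by
  have hp0 : 0 < p := by linarith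
  have hpos : ∀ a ∈ Icc α β, ∀ x, 0 < x →
      0 < powProfileDeriv2 p q (interpSlope p q a (a + ε)) (interpConst p q a (a + ε)) x := by
    intro a ha x hx
    have ha1 : 1 < a := hα.trans_le ha.1
    exact powProfileDeriv2_pos hp hq hpq (interpSlope_pos hp0 hq ha1 (by linarith))
      (interpConst_pos hp0 hq hpq ha1 (h a ha) (by linarith)) hx
  have hsub : Icc α β ⊆ Ioi (1 : ℝ) := fun a ha => hα.trans_le ha.1
  have hcont : ContinuousOn (fun z : ℝ × ℝ => powProfileDeriv2 p q (interpSlope p q z.1 (z.1 + ε))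
      (interpConst p q z.1 (z.1 + ε)) z.2) (Icc α β ×ˢ Icc α (β + ε)) := by
    intro z hz
    have hz1 : 1 < z.1 := hsub hz.1
    have hz2 : 0 < z.2 := by linarith [hz.2.1]
    have h1 : ContinuousWithinAt (fun z : ℝ × ℝ => (interpSlope p q z.1 (z.1 + ε),
        interpConst p q z.1 (z.1 + ε), z.2)) (Icc α β ×ˢ Icc α (β + ε)) z := by
      refine ContinuousWithinAt.prodMk ?_ (ContinuousWithinAt.prodMk ?_ (by fun_prop))
      · exact (((continuousOn_interpSlope hp0 hq hε).mono hsub) z.1 hz.1).comp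
          (f := fun z : ℝ × ℝ => z.1) (by fun_prop) (fun y hy => hy.1)
      · exact (((continuousOn_interpConst hp0 hq hε).mono hsub) z.1 hz.1).comp
          (f := fun z : ℝ × ℝ => z.1) (by fun_prop) (fun y hy => hy.1)
    have h2 := continuousAt_powProfileDeriv2 (p := p) (q := q)
      (z := (interpSlope p q z.1 (z.1 + ε), interpConst p q z.1 (z.1 + ε), z.2)) hz2
      (interp_pos hp0 hq hpq hz1 (h _ hz.1) (by linarith) hz2)
    exact ContinuousAt.comp_continuousWithinAt
      (f := fun z : ℝ × ℝ => (interpSlope p q z.1 (z.1 + ε),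
        interpConst p q z.1 (z.1 + ε), z.2)) h2 h1
  obtain ⟨z, hz, hmin⟩ := (isCompact_Icc.prod isCompact_Icc).exists_isMinOn
    ⟨(α, α), ⟨left_mem_Icc.2 hαβ, left_mem_Icc.2 (by linarith)⟩⟩ hcont
  refine ⟨_, half_pos (hpos z.1 hz.1 z.2 (by linarith [hz.2.1])), fun a ha x hx => ?_⟩
  rw [mul_div_cancel₀ _ two_ne_zero]
  exact hmin (a := (a, x)) ⟨ha, ha.1.trans hx.1, hx.2.trans (by linarith [ha.2])⟩

theorem interpGap_pos (hp : 1 ≤ p) (hq : 0 < q) (hpq : 1 < p * q) (ha : 1 < a)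
    (h : a ≤ p * q * (a - 1)) (hab : a < b) {y : ℝ} (hy : y ∈ Ioo a b) :
    0 < interpGap p q a b y := by
  obtain ⟨κ, hκ, hκ'⟩ := exists_pos_le_deriv2 hp hq hpq ha (β := a) (ε := b - a)
    (fun x hx => by rwa [le_antisymm hx.2 hx.1]) le_rfl (by linarith)
  have := hκ' a (by simp)
  rw [add_sub_cancel] at this
  refine lt_of_lt_of_le ?_ (interpGap_lower (by linarith) hq hpq ha h hab this
    (Ioo_subset_Icc_self hy))
  have := sub_pos.2 hy.1
  have := sub_pos.2 hy.2
  positivity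

end interp

theorem kernel_le {w c y d M κ : ℝ} (hM : 0 ≤ M) (hc : 0 ≤ c) (hy : 1 < y)
    (hκ : κ * c ^ 2 ≤ d) (hd : 0 < d) (hw0 : 0 ≤ w) (hw : w ≤ M ^ 2 * κ * (y * (y - 1) ^ 2)) :
    √w * c / (√y * (y - 1) * √d) ≤ M := by
  have hy1 : 0 < y - 1 := by linarith
  have hy0 : 0 < y := by linarith
  rw [div_le_iff₀ (by positivity), ← pow_le_pow_iff_left₀ (by positivity) (by positivity)
    two_ne_zero]
  simp only [mul_pow, sq_sqrt hw0, sq_sqrt hy0.le, sq_sqrt hd.le]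
  calc w * c ^ 2 ≤ M ^ 2 * κ * (y * (y - 1) ^ 2) * c ^ 2 := by gcongr
    _ = M ^ 2 * (y * (y - 1) ^ 2) * (κ * c ^ 2) := by ring
    _ ≤ M ^ 2 * (y * (y - 1) ^ 2) * d := by gcongr
    _ = _ := by ring

theorem one_le_kernel {w c y d κ : ℝ} (hc : 0 ≤ c) (hy : 1 < y)
    (hκ : d ≤ κ * c ^ 2) (hd : 0 < d) (hw0 : 0 ≤ w) (hw : κ * (y * (y - 1) ^ 2) ≤ w) :
    1 ≤ √w * c / (√y * (y - 1) * √d) := by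
  have hy1 : 0 < y - 1 := by linarith
  have hy0 : 0 < y := by linarith
  rw [le_div_iff₀ (by positivity), one_mul, ← pow_le_pow_iff_left₀ (by positivity)
    (by positivity) two_ne_zero]
  simp only [mul_pow, sq_sqrt hw0, sq_sqrt hy0.le, sq_sqrt hd.le]
  calc y * (y - 1) ^ 2 * d ≤ y * (y - 1) ^ 2 * (κ * c ^ 2) := by gcongr
    _ = κ * (y * (y - 1) ^ 2) * c ^ 2 := by ring
    _ ≤ w * c ^ 2 := by gcongr

/-- The point of the interval with endpoints `a`, `b` at angle `θ`. -/
noncomputable def sinNode (a b θ : ℝ) : ℝ := (a + b) / 2 + (b - a) / 2 * sin θ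

theorem sinNode_mul (a b θ : ℝ) :
    (sinNode a b θ - a) * (b - sinNode a b θ) = ((b - a) / 2 * cos θ) ^ 2 := by
  unfold sinNode
  linear_combination -(b - a) ^ 2 / 4 * (sin_sq_add_cos_sq θ)

theorem sinNode_mem_Ioo {a b θ : ℝ} (hab : a < b) (hθ : θ ∈ Ioo (-(π / 2)) (π / 2)) :
    sinNode a b θ ∈ Ioo a b := by
  have hc := cos_pos_of_mem_Ioo hθ
  have h := sin_sq_add_cos_sq θ
  have h1 : sin θ < 1 := by nlinarith [sin_le_one θ]
  have h2 : -1 < sin θ := by nlinarith [neg_one_le_sin θ]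
  unfold sinNode
  constructor <;> nlinarith

/-- The period in terms of the two zeros `a < b`, after desingularising the endpoints. -/
noncomputable def periodIntegrand (p q a b θ : ℝ) : ℝ :=
  √(powProfile p q (interpSlope p q a b) (interpConst p q a b) (sinNode a b θ)) *
      ((b - a) / 2 * cos θ) /
    (√(sinNode a b θ) * (sinNode a b θ - 1) * √(interpGap p q a b (sinNode a b θ)))

section period

variable {p q a b : ℝ}

theorem periodIntegrand_le (hp : 1 ≤ p) (hq : 0 < q) (hpq : 1 < p * q) (ha : 1 < a)
    (h : a ≤ p * q * (a - 1)) (hab : a < b) {κ M : ℝ} (hκ : ∀ x ∈ Icc a b,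
      2 * κ ≤ powProfileDeriv2 p q (interpSlope p q a b) (interpConst p q a b) x) (hM : 0 ≤ M)
    (hW : ∀ x ∈ Ioo a b, powProfile p q (interpSlope p q a b) (interpConst p q a b) x ≤
      M ^ 2 * κ * (x * (x - 1) ^ 2)) {θ : ℝ} (hθ : θ ∈ Ioo (-(π / 2)) (π / 2)) :
    periodIntegrand p q a b θ ≤ M := by
  have hy := sinNode_mem_Ioo hab hθ
  have hlow := interpGap_lower (by linarith) hq hpq ha h hab hκ (Ioo_subset_Icc_self hy)
  rw [sinNode_mul] at hlow
  have := cos_pos_of_mem_Ioo hθ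
  have := sub_pos.2 hab
  exact kernel_le hM (by positivity) (ha.trans hy.1) hlow (interpGap_pos hp hq hpq ha h hab hy)
    (rpow_nonneg (interp_pos (by linarith) hq hpq ha h hab (by linarith [hy.1])).le _) (hW _ hy)

theorem one_le_periodIntegrand (hp : 1 ≤ p) (hq : 0 < q) (hpq : 1 < p * q) (ha : 1 < a)
    (h : a ≤ p * q * (a - 1)) (hab : a < b) {κ : ℝ} (hκ : ∀ x ∈ Icc a b,
      powProfileDeriv2 p q (interpSlope p q a b) (interpConst p q a b) x ≤ 2 * κ)
    (hW : ∀ x ∈ Ioo a b, κ * (x * (x - 1) ^ 2) ≤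
      powProfile p q (interpSlope p q a b) (interpConst p q a b) x)
    {θ : ℝ} (hθ : θ ∈ Ioo (-(π / 2)) (π / 2)) :
    1 ≤ periodIntegrand p q a b θ := by
  have hy := sinNode_mem_Ioo hab hθ
  have hup := interpGap_upper (by linarith) hq hpq ha h hab hκ (Ioo_subset_Icc_self hy)
  rw [sinNode_mul] at hup
  have := cos_pos_of_mem_Ioo hθ
  have := sub_pos.2 hab
  exact one_le_kernel (by positivity) (ha.trans hy.1) hup (interpGap_pos hp hq hpq ha h hab hy)
    (rpow_nonneg (interp_pos (by linarith) hq hpq ha h hab (by linarith [hy.1])).le _) (hW _ hy)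

theorem periodIntegrand_nonneg (ha : 1 < a) (hab : a < b) {θ : ℝ}
    (hθ : θ ∈ Ioo (-(π / 2)) (π / 2)) : 0 ≤ periodIntegrand p q a b θ := by
  have hy := sinNode_mem_Ioo hab hθ
  have h1 := cos_pos_of_mem_Ioo hθ
  have h2 := sub_pos.2 hab
  have h3 : 0 < sinNode a b θ - 1 := by linarith [hy.1]
  unfold periodIntegrand
  positivity

theorem eventually_one_le_periodIntegrand (hp : 1 ≤ p) (hq : 0 < q) (hpq : 1 < p * q)
    (ha : 1 < a) (h : a ≤ p * q * (a - 1)) (hlim : (1 - q⁻¹) * a + (p - 1) * (a - 1) < 2) :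
    ∀ᶠ b in nhdsWithin a (Ioi a), ∀ θ ∈ Ioo (-(π / 2)) (π / 2),
      1 ≤ periodIntegrand p q a b θ := by
  have hp0 : 0 < p := by linarith
  have ha1 : 0 < a - 1 := by linarith
  set K := q⁻¹ * (a - 1) ^ (q⁻¹ - 1) / (p * a ^ (p - 1)) with hK
  have hB : K * a ^ p + ((a - 1) ^ q⁻¹ - K * a ^ p) = (a - 1) ^ q⁻¹ := by ring
  have hB0 : 0 < K * a ^ p + ((a - 1) ^ q⁻¹ - K * a ^ p) := by rw [hB]; positivity
  have hW : powProfile p q K ((a - 1) ^ q⁻¹ - K * a ^ p) a = a - 1 := by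
    unfold powProfile
    rw [hB, ← rpow_mul ha1.le, inv_mul_cancel₀ hq.ne', rpow_one]
  have hD := powProfileDeriv2_limit hp0 hq ha hK
  obtain ⟨κ, hκ1, hκ2⟩ : ∃ κ, powProfileDeriv2 p q K ((a - 1) ^ q⁻¹ - K * a ^ p) a < 2 * κ ∧
      κ * (a * (a - 1) ^ 2) < a - 1 := by
    obtain ⟨κ, hκ1, hκ2⟩ := exists_between
      (show powProfileDeriv2 p q K ((a - 1) ^ q⁻¹ - K * a ^ p) a / 2 < 1 / (a * (a - 1)) by
        rw [hD, div_lt_div_iff₀ two_pos (by positivity)]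
        have : ((q - 1) * a / (q * (a - 1)) + (p - 1)) / a * (a * (a - 1)) =
          (1 - q⁻¹) * a + (p - 1) * (a - 1) := by field_simp
        linarith)
    refine ⟨κ, by linarith, ?_⟩
    rw [lt_div_iff₀ (by positivity)] at hκ2
    nlinarith
  have c1 := (continuousAt_powProfileDeriv2 (p := p) (q := q)
    (z := (K, (a - 1) ^ q⁻¹ - K * a ^ p, a)) (by simp; linarith) hB0).eventually_lt_const hκ1
  have c2 : ∀ᶠ z : ℝ × ℝ × ℝ in nhds (K, (a - 1) ^ q⁻¹ - K * a ^ p, a),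
      κ * (z.2.2 * (z.2.2 - 1) ^ 2) < powProfile p q z.1 z.2.1 z.2.2 :=
    ContinuousAt.eventually_lt (by fun_prop) (continuousAt_powProfile (p := p) (q := q)
    (z := (K, (a - 1) ^ q⁻¹ - K * a ^ p, a)) (by simp; linarith) hB0) (by simpa [hW] using hκ2)
  filter_upwards [eventually_interp hp0 ha hK (c1.and c2), self_mem_nhdsWithin] with b hb hab θ hθ
  exact one_le_periodIntegrand hp hq hpq ha h hab (fun x hx => (hb x hx).1.le)
    (fun x hx => (hb x (Ioo_subset_Icc_self hx)).2.le) hθ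

theorem eventually_periodIntegrand_le_one (hp : 1 ≤ p) (hq : 0 < q) (hpq : 1 < p * q)
    (ha : 1 < a) (h : a ≤ p * q * (a - 1)) (hlim : 2 < (1 - q⁻¹) * a + (p - 1) * (a - 1)) :
    ∀ᶠ b in nhdsWithin a (Ioi a), ∀ θ ∈ Ioo (-(π / 2)) (π / 2),
      periodIntegrand p q a b θ ≤ 1 := by
  have hp0 : 0 < p := by linarith
  have ha1 : 0 < a - 1 := by linarith
  set K := q⁻¹ * (a - 1) ^ (q⁻¹ - 1) / (p * a ^ (p - 1)) with hK
  have hB : K * a ^ p + ((a - 1) ^ q⁻¹ - K * a ^ p) = (a - 1) ^ q⁻¹ := by ring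
  have hB0 : 0 < K * a ^ p + ((a - 1) ^ q⁻¹ - K * a ^ p) := by rw [hB]; positivity
  have hW : powProfile p q K ((a - 1) ^ q⁻¹ - K * a ^ p) a = a - 1 := by
    unfold powProfile
    rw [hB, ← rpow_mul ha1.le, inv_mul_cancel₀ hq.ne', rpow_one]
  have hD := powProfileDeriv2_limit hp0 hq ha hK
  obtain ⟨κ, hκ1, hκ2⟩ : ∃ κ, 2 * κ < powProfileDeriv2 p q K ((a - 1) ^ q⁻¹ - K * a ^ p) a ∧
      a - 1 < κ * (a * (a - 1) ^ 2) := by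
    obtain ⟨κ, hκ1, hκ2⟩ := exists_between
      (show 1 / (a * (a - 1)) < powProfileDeriv2 p q K ((a - 1) ^ q⁻¹ - K * a ^ p) a / 2 by
        rw [hD, div_lt_div_iff₀ (by positivity) two_pos]
        have : ((q - 1) * a / (q * (a - 1)) + (p - 1)) / a * (a * (a - 1)) =
          (1 - q⁻¹) * a + (p - 1) * (a - 1) := by field_simp
        linarith)
    refine ⟨κ, by linarith, ?_⟩
    rw [div_lt_iff₀ (by positivity)] at hκ1
    nlinarith
  have c1 := (continuousAt_powProfileDeriv2 (p := p) (q := q)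
    (z := (K, (a - 1) ^ q⁻¹ - K * a ^ p, a)) (by simp; linarith) hB0).eventually_const_lt hκ1
  have c2 : ∀ᶠ z : ℝ × ℝ × ℝ in nhds (K, (a - 1) ^ q⁻¹ - K * a ^ p, a),
      powProfile p q z.1 z.2.1 z.2.2 < κ * (z.2.2 * (z.2.2 - 1) ^ 2) :=
    ContinuousAt.eventually_lt (continuousAt_powProfile (p := p) (q := q)
    (z := (K, (a - 1) ^ q⁻¹ - K * a ^ p, a)) (by simp; linarith) hB0) (by fun_prop)
      (by simpa [hW] using hκ2)
  filter_upwards [eventually_interp hp0 ha hK (c1.and c2), self_mem_nhdsWithin] with b hb hab θ hθ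
  refine periodIntegrand_le hp hq hpq ha h hab (fun x hx => (hb x hx).1.le) zero_le_one
    (fun x hx => ?_) hθ
  simpa using (hb x (Ioo_subset_Icc_self hx)).2.le

theorem exists_forall_periodIntegrand_le (hp : 1 ≤ p) (hq : 0 < q) (hpq : 1 < p * q) {α β ε : ℝ}
    (hα : 1 < α) (h : ∀ a ∈ Icc α β, a ≤ p * q * (a - 1)) (hαβ : α ≤ β) (hε : 0 < ε) :
    ∃ M, ∀ a ∈ Icc α β, ∀ θ ∈ Ioo (-(π / 2)) (π / 2), periodIntegrand p q a (a + ε) θ ≤ M := by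
  obtain ⟨κ, hκ, hκ'⟩ := exists_pos_le_deriv2 hp hq hpq hα h hαβ hε
  have hα1 : 0 < α - 1 := by linarith
  refine ⟨√(1 / (κ * (α * (α - 1)))), fun a ha θ hθ => ?_⟩
  have ha1 : 1 < a := hα.trans_le ha.1
  refine periodIntegrand_le hp hq hpq ha1 (h a ha) (by linarith) (hκ' a ha) (by positivity)
    (fun x hx => ?_) hθ
  have hgap := interpGap_pos hp hq hpq ha1 (h a ha) (lt_add_of_pos_right a hε) hx
  have hαx : α ≤ x := ha.1.trans hx.1.le
  rw [sq_sqrt (by positivity)]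
  have hx1 : 0 ≤ x - 1 := by linarith
  have hx0 : 0 ≤ x := by linarith
  calc _ ≤ x - 1 := by unfold interpGap at hgap; linarith
    _ = 1 / (κ * (α * (α - 1))) * κ * (α * (α - 1)) * (x - 1) := by field_simp
    _ ≤ 1 / (κ * (α * (α - 1))) * κ * (x * (x - 1)) * (x - 1) := by gcongr
    _ = _ := by ring

theorem continuousOn_periodIntegrand (hp : 1 ≤ p) (hq : 0 < q) (hpq : 1 < p * q) {α β ε : ℝ}
    (hα : 1 < α) (h : ∀ a ∈ Icc α β, a ≤ p * q * (a - 1)) (hε : 0 < ε) :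
    ContinuousOn (fun z : ℝ × ℝ => periodIntegrand p q z.1 (z.1 + ε) z.2)
      (Icc α β ×ˢ Ioo (-(π / 2)) (π / 2)) := by
  intro z hz
  have hp0 : 0 < p := by linarith
  have hz1 : 1 < z.1 := hα.trans_le hz.1.1
  have hsub : Icc α β ⊆ Ioi (1 : ℝ) := fun a ha => hα.trans_le ha.1
  have hy := sinNode_mem_Ioo (lt_add_of_pos_right z.1 hε) hz.2
  have hgap := interpGap_pos hp hq hpq hz1 (h _ hz.1) (lt_add_of_pos_right _ hε) hy
  have hnode : Continuous (fun z : ℝ × ℝ => sinNode z.1 (z.1 + ε) z.2) := by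
    unfold sinNode; fun_prop
  have h1 : ContinuousWithinAt (fun z : ℝ × ℝ => (interpSlope p q z.1 (z.1 + ε),
      interpConst p q z.1 (z.1 + ε), sinNode z.1 (z.1 + ε) z.2))
      (Icc α β ×ˢ Ioo (-(π / 2)) (π / 2)) z := by
    refine ContinuousWithinAt.prodMk ?_ (ContinuousWithinAt.prodMk ?_
      hnode.continuousAt.continuousWithinAt)
    · exact (((continuousOn_interpSlope hp0 hq hε).mono hsub) z.1 hz.1).comp
        (f := fun z : ℝ × ℝ => z.1) (by fun_prop) (fun y hy => hy.1)
    · exact (((continuousOn_interpConst hp0 hq hε).mono hsub) z.1 hz.1).comp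
        (f := fun z : ℝ × ℝ => z.1) (by fun_prop) (fun y hy => hy.1)
  have h2 := continuousAt_powProfile (p := p) (q := q)
    (z := (interpSlope p q z.1 (z.1 + ε), interpConst p q z.1 (z.1 + ε),
      sinNode z.1 (z.1 + ε) z.2)) (by simp; linarith [hy.1])
    (interp_pos hp0 hq hpq hz1 (h _ hz.1) (by linarith) (by simp; linarith [hy.1]))
  have h3 : ContinuousWithinAt (fun z : ℝ × ℝ => powProfile p q (interpSlope p q z.1 (z.1 + ε))
      (interpConst p q z.1 (z.1 + ε)) (sinNode z.1 (z.1 + ε) z.2))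
      (Icc α β ×ˢ Ioo (-(π / 2)) (π / 2)) z := ContinuousAt.comp_continuousWithinAt
      (f := fun z : ℝ × ℝ => (interpSlope p q z.1 (z.1 + ε),
        interpConst p q z.1 (z.1 + ε), sinNode z.1 (z.1 + ε) z.2)) h2 h1
  have hn := hnode.continuousAt.continuousWithinAt (x := z)
    (s := Icc α β ×ˢ Ioo (-(π / 2)) (π / 2))
  unfold periodIntegrand
  refine ContinuousWithinAt.div (h3.sqrt.mul (by fun_prop))
    ((hn.sqrt.mul (hn.sub continuousWithinAt_const)).mul ?_) ?_
  · unfold interpGap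
    exact ((hn.sub continuousWithinAt_const).sub h3).sqrt
  · have h4 : 0 < sinNode z.1 (z.1 + ε) z.2 - 1 := by linarith [hy.1]
    have h5 : 0 < sinNode z.1 (z.1 + ε) z.2 := by linarith
    positivity

theorem exists_integral_periodIntegrand_eq_pi (hp : 1 ≤ p) (hq : 0 < q) (hpq : 1 < p * q) :
    ∃ a b, 1 < a ∧ a ≤ p * q * (a - 1) ∧ a < b ∧
      ∫ θ in Ioo (-(π / 2)) (π / 2), periodIntegrand p q a b θ = π := by
  have hd : 0 < p - q⁻¹ := by
    rw [sub_pos, inv_lt_iff_one_lt_mul₀ hq]; exact hpq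
  have hq' : 0 < q⁻¹ := by positivity
  have hgt : ∀ T, 1 ≤ T → 1 < (T + p - 1) / (p - q⁻¹) := fun T hT => by
    rw [lt_div_iff₀ hd]; linarith
  have heq : ∀ T, (1 - q⁻¹) * ((T + p - 1) / (p - q⁻¹)) +
      (p - 1) * ((T + p - 1) / (p - q⁻¹) - 1) = T := fun T => by
    have : (p - q⁻¹) * ((T + p - 1) / (p - q⁻¹)) = T + p - 1 := mul_div_cancel₀ _ hd.ne'
    linear_combination this
  have hle : ∀ a, (3 / 2 + p - 1) / (p - q⁻¹) ≤ a → a ≤ p * q * (a - 1) := fun a ha => by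
    rw [div_le_iff₀ hd] at ha
    have h1 : q * q⁻¹ = 1 := mul_inv_cancel₀ hq.ne'
    have : p * q * (a - 1) - a = q * (a * (p - q⁻¹) - p) := by linear_combination a * h1
    have : 0 ≤ q * (a * (p - q⁻¹) - p) := mul_nonneg hq.le (by linarith)
    linarith
  set α := (3 / 2 + p - 1) / (p - q⁻¹) with hα
  set β := (5 / 2 + p - 1) / (p - q⁻¹) with hβ
  have hα1 : 1 < α := hgt _ (by norm_num)
  have hαβ : α ≤ β := by rw [hα, hβ]; gcongr; norm_num
  have hβ1 : 1 < β := hα1.trans_le hαβ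
  have hshift : ∀ a : ℝ, Tendsto (fun ε => a + ε) (nhdsWithin 0 (Ioi 0)) (nhdsWithin a (Ioi a)) := by
    intro a
    refine tendsto_nhdsWithin_iff.2 ⟨?_, ?_⟩
    · exact tendsto_nhdsWithin_of_tendsto_nhds (Continuous.tendsto' (by fun_prop) _ _ (by simp))
    · filter_upwards [self_mem_nhdsWithin] with ε hε
      exact lt_add_of_pos_right a hε
  obtain ⟨ε, hlow, hup, hε⟩ := (((hshift α).eventually (eventually_one_le_periodIntegrand hp hq hpq
    hα1 (hle α le_rfl) (by rw [heq]; norm_num))).and (((hshift β).eventually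
    (eventually_periodIntegrand_le_one hp hq hpq hβ1 (hle β hαβ) (by rw [heq]; norm_num))).and
      self_mem_nhdsWithin)).exists
  have hε : 0 < ε := hε
  have h : ∀ a ∈ Icc α β, a ≤ p * q * (a - 1) := fun a ha => hle a ha.1
  obtain ⟨M, hM⟩ := exists_forall_periodIntegrand_le hp hq hpq hα1 h hαβ hε
  have hcont := continuousOn_periodIntegrand hp hq hpq hα1 h hε
  have hbound : ∀ a ∈ Icc α β, ∀ θ ∈ Ioo (-(π / 2)) (π / 2),
      ‖periodIntegrand p q a (a + ε) θ‖ ≤ M := fun a ha θ hθ => by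
    rw [Real.norm_of_nonneg (periodIntegrand_nonneg (hα1.trans_le ha.1)
      (lt_add_of_pos_right a hε) hθ)]
    exact hM a ha θ hθ
  have hmeas : ∀ a ∈ Icc α β, AEStronglyMeasurable (periodIntegrand p q a (a + ε))
      (volume.restrict (Ioo (-(π / 2)) (π / 2))) := fun a ha =>
    ContinuousOn.aestronglyMeasurable (hcont.comp (f := fun θ => (a, θ)) (by fun_prop)
      (fun θ hθ => ⟨ha, hθ⟩)) measurableSet_Ioo
  have hint : ∀ a ∈ Icc α β, IntegrableOn (periodIntegrand p q a (a + ε))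
      (Ioo (-(π / 2)) (π / 2)) := fun a ha =>
    Integrable.of_bound (hmeas a ha) M ((ae_restrict_iff' measurableSet_Ioo).2
      (Eventually.of_forall (hbound a ha)))
  have hF : ContinuousOn (fun a => ∫ θ in Ioo (-(π / 2)) (π / 2), periodIntegrand p q a (a + ε) θ)
      (Icc α β) := by
    refine continuousOn_of_dominated (bound := fun _ => M) hmeas (fun a ha =>
      (ae_restrict_iff' measurableSet_Ioo).2 (Eventually.of_forall (hbound a ha)))
      (integrableOn_const (by simp)) ((ae_restrict_iff' measurableSet_Ioo).2
      (Eventually.of_forall fun θ hθ => ?_))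
    exact hcont.comp (f := fun a => (a, θ)) (by fun_prop) (fun a ha => ⟨ha, hθ⟩)
  have hone : ∫ _ in Ioo (-(π / 2)) (π / 2), (1 : ℝ) = π := by
    simp [pi_pos.le]
  have hmem : π ∈ Icc (∫ θ in Ioo (-(π / 2)) (π / 2), periodIntegrand p q β (β + ε) θ)
      (∫ θ in Ioo (-(π / 2)) (π / 2), periodIntegrand p q α (α + ε) θ) := by
    have hc : IntegrableOn (fun _ => (1 : ℝ)) (Ioo (-(π / 2)) (π / 2)) :=
      integrableOn_const (by simp)
    constructor
    · refine (setIntegral_mono_on (hint β (right_mem_Icc.2 hαβ)) hc measurableSet_Ioo hup).trans ?_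
      rw [hone]
    · refine le_trans ?_ (setIntegral_mono_on hc (hint α (left_mem_Icc.2 hαβ)) measurableSet_Ioo
        hlow)
      rw [hone]
  obtain ⟨a, ha, hpi⟩ := intermediate_value_Icc' hαβ hF hmem
  exact ⟨a, a + ε, hα1.trans_le ha.1, h a ha, by linarith, hpi⟩

end period

theorem hasDerivAt_criticalFn {n m : ℕ} (hm : 1 ≤ m) {H v : ℝ} (hH : 0 < H) (hv : 0 < v) (C : ℝ) :
    HasDerivAt (fun u : ℝ => C - u ^ 2 * (u ^ (-(n : ℝ)) + H) ^ ((2 : ℝ) / m) - u ^ 2)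
      (2 * v * ((v ^ (-(n : ℝ)) + H) ^ ((2 : ℝ) / m - 1) *
        (((n : ℝ) / m - 1) * (v ^ (-(n : ℝ)) + H) - n / m * H) - 1)) v := by
  have hS : 0 < v ^ (-(n : ℝ)) + H := by positivity
  have h1 := ((((hasDerivAt_id v).rpow_const (p := -(n : ℝ)) (Or.inl hv.ne')).add_const H).rpow_const
    (p := (2 : ℝ) / m) (Or.inl hS.ne'))
  have h2 := hasDerivAt_pow 2 v
  refine (((h2.mul h1).const_sub C).sub h2).congr_deriv ?_
  have hm0 : (m : ℝ) ≠ 0 := by positivity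
  simp only [id]
  have e1 : v ^ (-(n : ℝ) - 1) = v ^ (-(n : ℝ)) / v := rpow_sub_one hv.ne' _
  have e2 : (v ^ (-(n : ℝ)) + H) ^ ((2 : ℝ) / m) =
      (v ^ (-(n : ℝ)) + H) ^ ((2 : ℝ) / m - 1) * (v ^ (-(n : ℝ)) + H) := by
    rw [← rpow_add_one hS.ne']; congr 1; ring
  rw [e1, e2]
  push_cast
  field_simp
  ring

theorem strictMono_critical {r a H x y : ℝ} (hr : 0 < r) (ha : 0 < a) (hH : 0 < H) (hx : 0 < x)
    (hxy : x < y) (hpos : 0 < x ^ (r - 1) * ((a - 1) * x - a * H)) :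
    x ^ (r - 1) * ((a - 1) * x - a * H) < y ^ (r - 1) * ((a - 1) * y - a * H) := by
  have hy : 0 < y := hx.trans hxy
  have key : ∀ z : ℝ, 0 < z → z ^ (r - 1) * ((a - 1) * z - a * H) =
      z ^ r * ((a - 1) - a * H / z) := fun z hz => by
    rw [rpow_sub_one hz.ne']; field_simp
  rw [key x hx, key y hy]
  rw [key x hx] at hpos
  have h1 : 0 < (a - 1) - a * H / x := (mul_pos_iff_of_pos_left (by positivity)).1 hpos
  have h2 : a * H / y ≤ a * H / x := by gcongr
  exact mul_lt_mul (rpow_lt_rpow hx.le hxy hr) (by linarith) h1 (by positivity)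

theorem eq_of_deriv_criticalFn_eq_zero {n m : ℕ} (hm : 1 ≤ m) (hmn : m < n) {H v w C D : ℝ}
    (hH : 0 < H) (hv : 0 < v) (hw : 0 < w)
    (h1 : deriv (fun u : ℝ => C - u ^ 2 * (u ^ (-(n : ℝ)) + H) ^ ((2 : ℝ) / m) - u ^ 2) v = 0)
    (h2 : deriv (fun u : ℝ => D - u ^ 2 * (u ^ (-(n : ℝ)) + H) ^ ((2 : ℝ) / m) - u ^ 2) w = 0) :
    v = w := by
  rw [(hasDerivAt_criticalFn hm hH hv C).deriv] at h1
  rw [(hasDerivAt_criticalFn hm hH hw D).deriv] at h2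
  have h1 := sub_eq_zero.1 ((mul_eq_zero.1 h1).resolve_left (by positivity))
  have h2 := sub_eq_zero.1 ((mul_eq_zero.1 h2).resolve_left (by positivity))
  have hn0 : 0 < n := by omega
  have hS : v ^ (-(n : ℝ)) + H = w ^ (-(n : ℝ)) + H := by
    rcases lt_trichotomy (v ^ (-(n : ℝ)) + H) (w ^ (-(n : ℝ)) + H) with h | h | h
    · have := strictMono_critical (r := (2 : ℝ) / m) (a := (n : ℝ) / m) (by positivity)
        (by positivity) hH (by positivity) h (by rw [h1]; exact one_pos)
      linarith
    · exact h
    · have := strictMono_critical (r := (2 : ℝ) / m) (a := (n : ℝ) / m) (by positivity)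
        (by positivity) hH (by positivity) h (by rw [h2]; exact one_pos)
      linarith
  have := add_right_cancel hS
  rw [rpow_neg hv.le, rpow_neg hw.le, inv_inj] at this
  exact (rpow_left_inj hv.le hw.le (by positivity)).1 this

theorem image_sqrt_div_sinNode {a b C : ℝ} (ha : 0 < a) (hab : a < b) (hC : 0 < C) :
    (fun θ => √(C / sinNode a b θ)) '' Ioo (-(π / 2)) (π / 2) = Ioo √(C / b) √(C / a) := by
  ext t
  constructor
  · rintro ⟨θ, hθ, rfl⟩
    have hy := sinNode_mem_Ioo hab hθ
    have hy0 := ha.trans hy.1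
    exact ⟨sqrt_lt_sqrt (by have := ha.trans hab; positivity)
      (div_lt_div_of_pos_left hC hy0 hy.2), sqrt_lt_sqrt (by positivity)
      (div_lt_div_of_pos_left hC ha hy.1)⟩
  · rintro ⟨h1, h2⟩
    have hb : 0 < b := ha.trans hab
    have ht : 0 < t := (sqrt_pos.2 (by positivity)).trans h1
    rw [sqrt_lt' ht, div_lt_comm₀ hb (by positivity)] at h1
    rw [lt_sqrt ht.le, lt_div_comm₀ (by positivity) ha] at h2
    have hba : 0 < b - a := sub_pos.2 hab
    have hl : -1 < (C / t ^ 2 - (a + b) / 2) / ((b - a) / 2) := by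
      rw [lt_div_iff₀ (by positivity)]; linarith
    have hu : (C / t ^ 2 - (a + b) / 2) / ((b - a) / 2) < 1 := by
      rw [div_lt_iff₀ (by positivity)]; linarith
    refine ⟨arcsin ((C / t ^ 2 - (a + b) / 2) / ((b - a) / 2)), ⟨neg_pi_div_two_lt_arcsin.2 hl,
      arcsin_lt_pi_div_two.2 hu⟩, ?_⟩
    have : sinNode a b (arcsin ((C / t ^ 2 - (a + b) / 2) / ((b - a) / 2))) = C / t ^ 2 := by
      unfold sinNode
      rw [sin_arcsin hl.le hu.le, mul_div_cancel₀ _ (by positivity)]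
      ring
    simp only [this]
    rw [div_div_cancel₀ hC.ne', sqrt_sq ht.le]

theorem injOn_sqrt_div_sinNode {a b C : ℝ} (ha : 0 < a) (hab : a < b) (hC : 0 < C) :
    InjOn (fun θ => √(C / sinNode a b θ)) (Ioo (-(π / 2)) (π / 2)) := by
  intro x hx y hy h
  have hx' := ha.trans (sinNode_mem_Ioo hab hx).1
  have hy' := ha.trans (sinNode_mem_Ioo hab hy).1
  have h := (sqrt_inj (by positivity) (by positivity)).1 h
  have h := (mul_left_cancel₀ hC.ne' ((div_eq_div_iff hx'.ne' hy'.ne').1 h)).symm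
  unfold sinNode at h
  have hba : (b - a) / 2 ≠ 0 := by have := sub_pos.2 hab; positivity
  exact injOn_sin (Ioo_subset_Icc_self hx) (Ioo_subset_Icc_self hy)
    (mul_left_cancel₀ hba (add_left_cancel h))

theorem hasDerivAt_sqrt_div_sinNode {a b C θ : ℝ} (hC : 0 < C) (hy : 0 < sinNode a b θ) :
    HasDerivAt (fun θ => √(C / sinNode a b θ))
      (-(C * ((b - a) / 2 * cos θ) / (sinNode a b θ ^ 2 * (2 * √(C / sinNode a b θ))))) θ := by
  have h1 : HasDerivAt (sinNode a b) ((b - a) / 2 * cos θ) θ :=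
    (((hasDerivAt_sin θ).const_mul ((b - a) / 2)).const_add ((a + b) / 2))
  have h2 := ((hasDerivAt_const θ C).div h1 hy.ne').sqrt (div_pos hC hy).ne'
  refine h2.congr_deriv ?_
  simp only [Pi.div_apply]
  field_simp
  ring

/-- Analytic core of Theorem 5.2: for any integers `n > m ≥ 1` there exist `H > 0` and
`C > c₀(H)` such that the period `P(H,m,n,C)` equals `π`. Here
`q_C(v) = C - v²(v^{-n}+H)^{2/m} - v²`, `v₀` is its unique positive critical point
(independent of `C`), `c₀ = v₀²(v₀^{-n}+H)^{2/m} + v₀²`, `t₁ < v₀ < t₂` are the two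
positive zeros of `q_C`, and
`P(H,m,n,C) = 2∫_{t₁}^{t₂} √C t (t^{-n}+H)^{1/m} / ((C-t²)√(q_C(t))) dt`. -/
theorem exists_period_pi (n m : ℕ) (hm : 1 ≤ m) (hmn : m < n) :
    ∃ H : ℝ, 0 < H ∧ ∃ v₀ : ℝ, 0 < v₀ ∧
      (∀ C : ℝ,
        deriv (fun u : ℝ => C - u ^ 2 * (u ^ (-(n : ℝ)) + H) ^ ((2 : ℝ) / m) - u ^ 2) v₀
          = 0) ∧
      (∀ C v : ℝ, 0 < v →
        deriv (fun u : ℝ => C - u ^ 2 * (u ^ (-(n : ℝ)) + H) ^ ((2 : ℝ) / m) - u ^ 2) v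
          = 0 → v = v₀) ∧
      ∃ C : ℝ, v₀ ^ 2 * (v₀ ^ (-(n : ℝ)) + H) ^ ((2 : ℝ) / m) + v₀ ^ 2 < C ∧
        ∃ t₁ t₂ : ℝ, 0 < t₁ ∧ t₁ < v₀ ∧ v₀ < t₂ ∧
          C - t₁ ^ 2 * (t₁ ^ (-(n : ℝ)) + H) ^ ((2 : ℝ) / m) - t₁ ^ 2 = 0 ∧
          C - t₂ ^ 2 * (t₂ ^ (-(n : ℝ)) + H) ^ ((2 : ℝ) / m) - t₂ ^ 2 = 0 ∧
          2 * ∫ t in t₁..t₂,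
              Real.sqrt C * t * (t ^ (-(n : ℝ)) + H) ^ ((1 : ℝ) / m) /
                ((C - t ^ 2) *
                  Real.sqrt (C - t ^ 2 * (t ^ (-(n : ℝ)) + H) ^ ((2 : ℝ) / m) - t ^ 2)) =
            π := by
  have hm0 : (0 : ℝ) < m := by positivity
  have hn0 : (0 : ℝ) < n := by have : 0 < n := by omega
                               positivity
  have hp : 1 ≤ (n : ℝ) / 2 := by
    have : (2 : ℝ) ≤ n := by exact_mod_cast (by omega : 2 ≤ n)
    linarith
  have hp0 : 0 < (n : ℝ) / 2 := by linarith
  have hq : 0 < (2 : ℝ) / m := by positivity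
  have hpq : 1 < (n : ℝ) / 2 * (2 / m) := by
    have : (m : ℝ) < n := by exact_mod_cast hmn
    rw [show (n : ℝ) / 2 * (2 / m) = n / m by field_simp, one_lt_div hm0]
    exact this
  obtain ⟨a, b, ha, h, hab, hpi⟩ := exists_integral_periodIntegrand_eq_pi hp hq hpq
  have ha0 : 0 < a := by linarith
  have hb0 : 0 < b := by linarith
  have hH := interpConst_pos hp0 hq hpq ha h hab
  have hK := interpSlope_pos hp0 hq ha hab
  have hgap := fun y hy => interpGap_pos hp hq hpq ha h hab (y := y) hy
  have hgapa := interpGap_left (p := (n : ℝ) / 2) (b := b) hq ha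
  have hgapb := interpGap_right hp0 hq ha hab
  unfold periodIntegrand at hpi
  unfold interpGap at hpi hgap hgapa hgapb
  set H := interpConst ((n : ℝ) / 2) (2 / m) a b
  set K := interpSlope ((n : ℝ) / 2) (2 / m) a b
  obtain ⟨C, hC, hCK⟩ : ∃ C : ℝ, 0 < C ∧ K * C ^ ((n : ℝ) / 2) = 1 :=
    ⟨K ^ (-((n : ℝ) / 2)⁻¹), by positivity, by
      rw [← rpow_mul hK.le, neg_mul, inv_mul_cancel₀ hp0.ne', rpow_neg_one, mul_inv_cancel₀ hK.ne']⟩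
  have hpow : ∀ y : ℝ, 0 < y → √(C / y) ^ (-(n : ℝ)) = K * y ^ ((n : ℝ) / 2) := fun y hy => by
    have hCp : 0 < C ^ ((n : ℝ) / 2) := by positivity
    rw [sqrt_eq_rpow, ← rpow_mul (by positivity), show 1 / 2 * -(n : ℝ) = -(n / 2) by ring,
      rpow_neg (by positivity), div_rpow hC.le hy.le, inv_div, div_eq_iff hCp.ne']
    linear_combination - y ^ ((n : ℝ) / 2) * hCK
  have hfn : ∀ y : ℝ, 0 < y →
      C - √(C / y) ^ 2 * (√(C / y) ^ (-(n : ℝ)) + H) ^ ((2 : ℝ) / m) - √(C / y) ^ 2 =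
        C / y * (y - 1 - powProfile ((n : ℝ) / 2) (2 / m) K H y) := fun y hy => by
    rw [hpow y hy, sq_sqrt (by positivity)]
    unfold powProfile
    field_simp
    ring
  have ht : √(C / b) < √(C / a) :=
    sqrt_lt_sqrt (by positivity) (div_lt_div_of_pos_left hC ha0 hab)
  have ht1 : 0 < √(C / b) := by positivity
  have hz1 := hfn b hb0
  rw [hgapb, mul_zero] at hz1
  have hz2 := hfn a ha0
  rw [hgapa, mul_zero] at hz2
  obtain ⟨v₀, hv, hdv⟩ := exists_deriv_eq_zero (f := fun u : ℝ =>
      C - u ^ 2 * (u ^ (-(n : ℝ)) + H) ^ ((2 : ℝ) / m) - u ^ 2) ht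
    (fun t ht => (hasDerivAt_criticalFn hm hH
      (ht1.trans_le ht.1) C).continuousAt.continuousWithinAt) (hz1.trans hz2.symm)
  have hv0 := ht1.trans hv.1
  refine ⟨H, hH, v₀, hv0, fun D => ?_, fun D v hvpos hD =>
    eq_of_deriv_criticalFn_eq_zero hm hmn hH hvpos hv0 hD hdv, C, ?_, √(C / b), √(C / a), ht1,
    hv.1, hv.2, hz1, hz2, ?_⟩
  · rwa [(hasDerivAt_criticalFn hm hH hv0 D).deriv,
      ← (hasDerivAt_criticalFn hm hH hv0 C).deriv]
  · rw [← image_sqrt_div_sinNode ha0 hab hC] at hv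
    obtain ⟨θ, hθ, rfl⟩ := hv
    have hy := sinNode_mem_Ioo hab hθ
    have hy0 := ha0.trans hy.1
    have := mul_pos (div_pos hC hy0) (hgap _ hy)
    rw [← hfn _ hy0] at this
    simp only
    linarith
  · rw [intervalIntegral.integral_of_le ht.le, integral_Ioc_eq_integral_Ioo,
      ← image_sqrt_div_sinNode ha0 hab hC,
      integral_image_eq_integral_abs_deriv_smul measurableSet_Ioo (fun θ hθ =>
        (hasDerivAt_sqrt_div_sinNode hC
          (ha0.trans (sinNode_mem_Ioo hab hθ).1)).hasDerivWithinAt)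
        (injOn_sqrt_div_sinNode ha0 hab hC), ← integral_const_mul]
    refine Eq.trans (setIntegral_congr_fun measurableSet_Ioo fun θ hθ => ?_) hpi
    have hy := sinNode_mem_Ioo hab hθ
    have hg := hgap _ hy
    have hc : 0 < (b - a) / 2 * cos θ := mul_pos (by linarith) (cos_pos_of_mem_Ioo hθ)
    have hy0 := ha0.trans hy.1
    have hy1 : 0 < sinNode a b θ - 1 := by linarith [hy.1]
    simp only [hfn _ hy0]
    rw [hpow _ hy0, abs_neg, abs_of_pos (by positivity), smul_eq_mul, sq_sqrt (by positivity)]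
    have hW : (K * sinNode a b θ ^ ((n : ℝ) / 2) + H) ^ ((1 : ℝ) / m) =
        √(powProfile ((n : ℝ) / 2) (2 / m) K H (sinNode a b θ)) := by
      unfold powProfile
      rw [sqrt_eq_rpow, ← rpow_mul (by positivity)]
      congr 1
      field_simp
    rw [hW, sqrt_mul (by positivity)]
    generalize √(powProfile ((n : ℝ) / 2) (2 / m) K H (sinNode a b θ)) = w
    have hg' := sqrt_pos.2 hg
    generalize √(sinNode a b θ - 1 - powProfile ((n : ℝ) / 2) (2 / m) K H (sinNode a b θ)) = g
      at hg' ⊢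
    generalize (b - a) / 2 * cos θ = c
    generalize sinNode a b θ = y at hy0 hy1 ⊢
    rw [show C - C / y = C * (y - 1) / y by field_simp, sqrt_div hC.le]
    have hsy : √y ^ 2 = y := sq_sqrt hy0.le
    have := sqrt_pos.2 hC
    have := sqrt_pos.2 hy0
    field_simp
    simp only [hsy]
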